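/- arXiv:2601.07681 — 2 statements merged into one kernel-verified Lean document; each statement's English description precedes it below -/
import Mathlib

section
/- Let H be a generalised Hénon map with degree d ≥ 2. The set 𝓛 of affine automorphisms L of ℂ² satisfying L(K⁺) = K⁺ and L(K⁻) = K⁻ is a subgroup of Aut(ℂ²) under composition, it is finite, and it is isomorphic to a subgroup of the cyclic group ℤ/((d+d')(d−1))ℤ; in particular 𝓛 is cyclic and its order divides (d+d')·(d−1). -/
noncomputable section

open Complex Filter Set Topology

/-- A simple Hénon factor `(x, y) ↦ (y, p(y) - a·x)`. -/
def henonStep (p : Polynomial ℂ) (a : ℂ) : ℂ × ℂ → ℂ × ℂ :=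
  fun z => (z.2, p.eval z.2 - a * z.1)

/-- The inverse of a simple Hénon factor. -/
def henonStepInv (p : Polynomial ℂ) (a : ℂ) : ℂ × ℂ → ℂ × ℂ :=
  fun w => ((p.eval w.1 - w.2) / a, w.1)

/-- The data of a generalised Hénon map `H = H_m ∘ ⋯ ∘ H_1`, where
`H_i(x,y) = (y, p_i(y) - a_i x)` with `deg p_i ≥ 2` and `a_i ≠ 0`. -/
structure GenHenon where
  m : ℕ
  hm : 0 < m
  p : Fin m → Polynomial ℂ
  a : Fin m → ℂ
  hdeg : ∀ i, 2 ≤ (p i).natDegree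
  ha : ∀ i, a i ≠ 0

namespace GenHenon

/-- The generalised Hénon map itself: apply `H_1` first, then `H_2`, ..., then `H_m`. -/
def toFun (H : GenHenon) : ℂ × ℂ → ℂ × ℂ :=
  fun z => (List.ofFn fun i => henonStep (H.p i) (H.a i)).foldl (fun w g => g w) z

/-- The inverse map `H⁻¹ = H_1⁻¹ ∘ ⋯ ∘ H_m⁻¹`: apply `H_m⁻¹` first. -/
def invFun (H : GenHenon) : ℂ × ℂ → ℂ × ℂ :=
  fun z => ((List.ofFn fun i => henonStepInv (H.p i) (H.a i)).reverse).foldl (fun w g => g w) z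

/-- The degree `d = d_1 ⋯ d_m`. -/
def deg (H : GenHenon) : ℕ := ∏ i, (H.p i).natDegree

/-- The codegree `d' = d_1 ⋯ d_{m-1}` (equal to `1` when `m = 1`). -/
def deg' (H : GenHenon) : ℕ :=
  ∏ i : Fin H.m, if (i : ℕ) + 1 < H.m then (H.p i).natDegree else 1

/-- The Jacobian determinant `a = a_1 ⋯ a_m`. -/
def jac (H : GenHenon) : ℂ := ∏ i, H.a i

/-- The iterate `H^s`, `s ∈ ℤ`: `s`-th iterate of `H` for `s ≥ 0`, `|s|`-th iterate of `H⁻¹`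
for `s < 0`. -/
def zIter (H : GenHenon) (s : ℤ) : ℂ × ℂ → ℂ × ℂ :=
  if 0 ≤ s then H.toFun^[s.toNat] else H.invFun^[(-s).toNat]

/-- The non-escaping set `K⁺`. -/
def Kplus (H : GenHenon) : Set (ℂ × ℂ) :=
  {z | Bornology.IsBounded (Set.range fun n : ℕ => H.toFun^[n] z)}

/-- The non-escaping set `K⁻` of the inverse. -/
def Kminus (H : GenHenon) : Set (ℂ × ℂ) :=
  {z | Bornology.IsBounded (Set.range fun n : ℕ => H.invFun^[n] z)}

/-- The escaping set `U⁺ = ℂ² ∖ K⁺`. -/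
def Uplus (H : GenHenon) : Set (ℂ × ℂ) := (H.Kplus)ᶜ

lemma deg_pos (H : GenHenon) : 0 < H.deg :=
  Finset.prod_pos fun i _ => lt_of_lt_of_le two_pos (H.hdeg i)

end GenHenon

/-- `f` is a holomorphic automorphism of `ℂ²`. -/
def IsAutC2 (f : ℂ × ℂ → ℂ × ℂ) : Prop :=
  Differentiable ℂ f ∧ ∃ g : ℂ × ℂ → ℂ × ℂ,
    Differentiable ℂ g ∧ Function.LeftInverse g f ∧ Function.RightInverse g f

/-- `L` is an affine automorphism of `ℂ²`: `L z = T z + b` with `T` an invertible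
`ℂ`-linear map. -/
def IsAffineAut (L : ℂ × ℂ → ℂ × ℂ) : Prop :=
  ∃ (T : (ℂ × ℂ) ≃ₗ[ℂ] ℂ × ℂ) (b : ℂ × ℂ), ∀ z, L z = T z + b

/-- The group `Aut(ℂ²)` of holomorphic automorphisms of `ℂ²`, as a subgroup of the
permutation group of `ℂ²`. -/
def autC2Group : Subgroup (Equiv.Perm (ℂ × ℂ)) where
  carrier := {f | Differentiable ℂ f ∧ Differentiable ℂ f.symm}
  one_mem' := ⟨differentiable_id, differentiable_id⟩
  mul_mem' := fun hf hg => ⟨hf.1.comp hg.1, hg.2.comp hf.2⟩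
  inv_mem' := fun hf => ⟨hf.2, hf.1⟩

open Polynomial Bornology

lemma tendsto_eval_div_pow_natDegree (p : ℂ[X]) :
    Tendsto (fun y => p.eval y / y ^ p.natDegree) (cobounded ℂ) (𝓝 p.leadingCoeff) := by
  have h : Tendsto (fun y : ℂ => p.reverse.eval y⁻¹) (cobounded ℂ) (𝓝 (p.reverse.eval 0)) :=
    (p.reverse.continuous.tendsto 0).comp tendsto_inv₀_cobounded
  rw [← coeff_zero_eq_eval_zero, coeff_zero_reverse] at h
  refine h.congr' ?_
  filter_upwards [eventually_ne_cobounded (0 : ℂ)] with y hy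
  let _ := invertibleOfNonzero hy
  have := eval₂_reverse_mul_pow (RingHom.id ℂ) y p
  rw [invOf_eq_inv] at this
  rw [eq_div_iff (pow_ne_zero _ hy)]
  simpa [eval₂_eq_eval_map] using this

lemma eventually_mul_norm_le_norm_eval {p : ℂ[X]} (hp : 2 ≤ p.natDegree) (B : ℝ) :
    ∀ᶠ y in cobounded ℂ, B * ‖y‖ ≤ ‖p.eval y‖ := by
  have hd : 0 < p.divX.degree := by
    rw [← natDegree_pos_iff_degree_pos, natDegree_divX_eq_natDegree_tsub_one]
    omega
  have h := p.divX.tendsto_norm_atTop hd (tendsto_norm_cobounded_atTop (E := ℂ))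
  filter_upwards [h.eventually_ge_atTop (B + 1),
    (tendsto_norm_cobounded_atTop (E := ℂ)).eventually_ge_atTop ‖p.coeff 0‖] with y h1 h2
  have h3 : p.eval y = p.divX.eval y * y + p.coeff 0 := by
    conv_lhs => rw [← divX_mul_X_add p]
    simp
  have h4 := norm_sub_le_norm_add (p.divX.eval y * y) (p.coeff 0)
  rw [← h3, norm_mul] at h4
  nlinarith [norm_nonneg y]

/-- A polynomial growing slower than every linear function is constant. -/
lemma natDegree_eq_zero_of_forall_norm_eval_le {q : ℂ[X]}
    (h : ∀ ε > 0, ∃ C : ℝ, ∀ u, ‖q.eval u‖ ≤ C + ε * ‖u‖) : q.natDegree = 0 := by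
  by_contra hq
  have hlim := (tendsto_eval_div_pow_natDegree q).norm
  have hpos : 0 < ‖q.leadingCoeff‖ := by
    rw [norm_pos_iff, Ne, leadingCoeff_eq_zero]
    rintro rfl
    simp at hq
  obtain ⟨C, hC⟩ := h (‖q.leadingCoeff‖ / 4) (by positivity)
  have hev : ∀ᶠ u in cobounded ℂ, ‖q.eval u / u ^ q.natDegree‖ ≤ ‖q.leadingCoeff‖ / 2 := by
    have hnorm := tendsto_norm_cobounded_atTop (E := ℂ)
    filter_upwards [hnorm.eventually_ge_atTop 1,
      hnorm.eventually_ge_atTop (C / (‖q.leadingCoeff‖ / 4))] with u h1 h2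
    rw [div_le_iff₀ (by positivity)] at h2
    have h3 : ‖u‖ ≤ ‖u‖ ^ q.natDegree := le_self_pow₀ h1 hq
    rw [norm_div, norm_pow, div_le_iff₀ (by positivity)]
    nlinarith [hC u]
  linarith [le_of_tendsto hlim hev]

/-- The first `n` steps of the non-autonomous Hénon system with factors given by `s`. -/
def henonOrbit (s : ℕ → ℂ[X] × ℂ) : ℕ → ℂ × ℂ → ℂ × ℂ
  | 0, z => z
  | n + 1, z => henonStep (s n).1 (s n).2 (henonOrbit s n z)

/-- The points with bounded forward orbit under the non-autonomous system `s`. -/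
def nonEscaping (s : ℕ → ℂ[X] × ℂ) : Set (ℂ × ℂ) :=
  {z | IsBounded (range fun n => henonOrbit s n z)}

lemma mem_nonEscaping_iff {s : ℕ → ℂ[X] × ℂ} {z : ℂ × ℂ} :
    z ∈ nonEscaping s ↔ IsBounded (range fun n => henonOrbit s n z) :=
  Iff.rfl

/-- A sequence of Hénon factors taking finitely many values. -/
structure IsHenonSeq (s : ℕ → ℂ[X] × ℂ) : Prop where
  finite_range : (range s).Finite
  two_le_natDegree : ∀ n, 2 ≤ (s n).1.natDegree
  ne_zero : ∀ n, (s n).2 ≠ 0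

lemma henonOrbit_shift (s : ℕ → ℂ[X] × ℂ) (n : ℕ) (z : ℂ × ℂ) :
    henonOrbit (fun k => s (k + 1)) n (henonStep (s 0).1 (s 0).2 z) = henonOrbit s (n + 1) z := by
  induction n with
  | zero => rfl
  | succ n ih => rw [henonOrbit, ih]; rfl

lemma henonStep_mem_nonEscaping_iff {s : ℕ → ℂ[X] × ℂ} {z : ℂ × ℂ} :
    henonStep (s 0).1 (s 0).2 z ∈ nonEscaping (fun k => s (k + 1)) ↔ z ∈ nonEscaping s := by
  simp only [mem_nonEscaping_iff, henonOrbit_shift]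
  refine ⟨fun h => (h.union (isBounded_singleton (x := z))).subset ?_, fun h => h.subset ?_⟩
  · rintro _ ⟨n, rfl⟩
    cases n with
    | zero => right; rfl
    | succ n => left; exact ⟨n, rfl⟩
  · rintro _ ⟨n, rfl⟩
    exact ⟨n + 1, rfl⟩

namespace IsHenonSeq

variable {s : ℕ → ℂ[X] × ℂ}

lemma shift (hs : IsHenonSeq s) : IsHenonSeq fun k => s (k + 1) where
  finite_range := hs.finite_range.subset (range_comp_subset_range (· + 1) s)
  two_le_natDegree n := hs.two_le_natDegree (n + 1)
  ne_zero n := hs.ne_zero (n + 1)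

/-- Far out in the cone `ε * ‖x‖ ≤ ‖y‖`, every factor at least doubles the second coordinate. -/
lemma exists_radius (hs : IsHenonSeq s) {ε : ℝ} (hε : 0 < ε) :
    ∃ R : ℝ, 0 ≤ R ∧ ∀ n (z : ℂ × ℂ), R < ‖z.2‖ → ε * ‖z.1‖ ≤ ‖z.2‖ →
      2 * ‖z.2‖ ≤ ‖(henonStep (s n).1 (s n).2 z).2‖ := by
  have h : ∀ᶠ y in cobounded ℂ, ∀ t ∈ range s, (‖t.2‖ / ε + 2) * ‖y‖ ≤ ‖t.1.eval y‖ := by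
    rw [Filter.eventually_all_finite hs.finite_range]
    rintro _ ⟨n, rfl⟩
    exact eventually_mul_norm_le_norm_eval (hs.two_le_natDegree n) _
  obtain ⟨R, -, hR⟩ := (hasBasis_cobounded_norm (E := ℂ)).eventually_iff.1 h
  refine ⟨max R 0, le_max_right _ _, fun n z hz hcone => ?_⟩
  have h1 := hR (show z.2 ∈ _ from (le_max_left R 0).trans hz.le) (s n) ⟨n, rfl⟩
  have h2 : ‖(s n).2 * z.1‖ ≤ ‖(s n).2‖ / ε * ‖z.2‖ := by
    rw [norm_mul, div_mul_eq_mul_div, le_div_iff₀ hε, mul_assoc]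
    gcongr
    linarith
  have h3 := norm_sub_norm_le ((s n).1.eval z.2) ((s n).2 * z.1)
  simp only [henonStep]
  linarith

lemma exists_bound (hs : IsHenonSeq s) {ε : ℝ} (hε : 0 < ε) :
    ∃ R : ℝ, ∀ z ∈ nonEscaping s, ‖z.2‖ ≤ R + ε * ‖z.1‖ := by
  obtain ⟨R, hR0, hR⟩ := hs.exists_radius (ε := min ε 1) (by positivity)
  refine ⟨R, fun z hz => ?_⟩
  by_contra! hlt
  have hRz : R < ‖z.2‖ := by nlinarith [norm_nonneg z.1]
  have hgrow : ∀ n, 2 ^ n * ‖z.2‖ ≤ ‖(henonOrbit s n z).2‖ ∧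
      min ε 1 * ‖(henonOrbit s n z).1‖ ≤ ‖(henonOrbit s n z).2‖ := by
    intro n
    induction n with
    | zero =>
      refine ⟨by simp [henonOrbit], ?_⟩
      have : min ε 1 * ‖z.1‖ ≤ ε * ‖z.1‖ := by gcongr; exact min_le_left _ _
      simp only [henonOrbit]
      linarith
    | succ n ih =>
      have h1 : (1 : ℝ) ≤ 2 ^ n := one_le_pow₀ one_le_two
      have h2 := hR n _ (by nlinarith [norm_nonneg z.2]) ih.2
      have h3 : min ε 1 * ‖(henonOrbit s n z).2‖ ≤ 1 * ‖(henonOrbit s n z).2‖ := by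
        gcongr; exact min_le_right _ _
      refine ⟨by rw [henonOrbit, pow_succ]; linarith, ?_⟩
      change min ε 1 * ‖(henonOrbit s n z).2‖ ≤ _
      rw [henonOrbit]
      linarith [norm_nonneg (henonOrbit s n z).2]
  obtain ⟨C, hC⟩ := (mem_nonEscaping_iff.1 hz).exists_norm_le
  have hz0 : 0 < ‖z.2‖ := by linarith
  obtain ⟨n, hn⟩ := pow_unbounded_of_one_lt (C / ‖z.2‖) one_lt_two
  rw [div_lt_iff₀ hz0] at hn
  have := hC _ ⟨n, rfl⟩
  linarith [(hgrow n).1, norm_snd_le (henonOrbit s n z)]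

/-- Every vertical line meets the non-escaping set. -/
lemma exists_mem_nonEscaping (hs : IsHenonSeq s) (x : ℂ) : ∃ y, (x, y) ∈ nonEscaping s := by
  obtain ⟨R, hR0, hR⟩ := hs.exists_radius one_pos
  have hpoly : ∀ n, ∃ P Q : ℂ[X], (∀ y, henonOrbit s n (x, y) = (P.eval y, Q.eval y)) ∧
      P.natDegree < Q.natDegree := by
    intro n
    induction n with
    | zero => exact ⟨C x, X, by simp [henonOrbit], by simp⟩
    | succ n ih =>
      obtain ⟨P, Q, hPQ, hlt⟩ := ih
      have hcomp : Q.natDegree < ((s n).1.comp Q).natDegree := by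
        rw [natDegree_comp]
        nlinarith [hs.two_le_natDegree n]
      refine ⟨Q, (s n).1.comp Q - C (s n).2 * P,
        fun y => by simp [henonOrbit, hPQ, henonStep], ?_⟩
      rwa [natDegree_sub_eq_left_of_natDegree_lt]
      exact (natDegree_C_mul_le _ _).trans_lt (hlt.trans hcomp)
  let E : ℕ → Set ℂ := fun n =>
    {y | ‖(henonOrbit s n (x, y)).2‖ ≤ max R ‖(henonOrbit s n (x, y)).1‖}
  have hE : (⋂ n, E n).Nonempty := by
    have hclosed : ∀ n, IsClosed (E n) := fun n => by
      obtain ⟨P, Q, hPQ, -⟩ := hpoly n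
      simp only [E, hPQ]
      exact isClosed_le (by fun_prop) (by fun_prop)
    refine IsCompact.nonempty_iInter_of_sequence_nonempty_isCompact_isClosed E
      (fun n y hy => ?_) (fun n => ?_) ?_ hclosed
    · by_contra hn
      simp only [E, mem_ofPred_eq, not_le, max_lt_iff] at hn hy
      have h1 := hR n _ hn.1 (by linarith [hn.2])
      have h2 : (henonOrbit s (n + 1) (x, y)).1 = (henonOrbit s n (x, y)).2 := rfl
      rw [h2, henonOrbit, max_eq_right hn.1.le] at hy
      linarith
    · obtain ⟨P, Q, hPQ, hlt⟩ := hpoly n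
      obtain ⟨y, hy⟩ := IsAlgClosed.exists_root Q
        (natDegree_pos_iff_degree_pos.1 (hlt.pos)).ne'
      exact ⟨y, by simp [E, hPQ, hy.eq_zero, hR0]⟩
    · refine Metric.isCompact_of_isClosed_isBounded (hclosed 0)
        ((Metric.isBounded_closedBall (x := 0) (r := max R ‖x‖)).subset fun y hy => ?_)
      simpa [E, henonOrbit] using hy
  obtain ⟨y, hy⟩ := hE
  refine ⟨y, mem_nonEscaping_iff.2 <| isBounded_iff_forall_norm_le.2 ⟨max R ‖x‖, ?_⟩⟩
  rintro _ ⟨n, rfl⟩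
  have key : ∀ n, ‖(henonOrbit s n (x, y)).1‖ ≤ max R ‖x‖ := by
    intro n
    induction n with
    | zero => exact le_max_right _ _
    | succ n ih => exact (mem_iInter.1 hy n).trans (max_le (le_max_left _ _) ih)
  exact max_le (key n) (key (n + 1))

/-- Along the non-escaping set, `x / y ^ d` converges as `x → ∞`, where `d` is the degree of the
first factor. -/
lemma tendsto_of_mem_nonEscaping (hs : IsHenonSeq s) {ι : Type*} {l : Filter ι} {z : ι → ℂ × ℂ}
    (hz : ∀ i, z i ∈ nonEscaping s) (hx : Tendsto (fun i => (z i).1) l (cobounded ℂ)) :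
    Tendsto (fun i => (z i).2) l (cobounded ℂ) ∧
    Tendsto (fun i => (z i).1 / (z i).2 ^ (s 0).1.natDegree) l
      (𝓝 ((s 0).1.leadingCoeff / (s 0).2)) := by
  obtain ⟨R, hR⟩ := hs.shift.exists_bound one_pos
  have ha := hs.ne_zero 0
  have hw : ∀ i, ‖(s 0).1.eval (z i).2 - (s 0).2 * (z i).1‖ ≤ R + ‖(z i).2‖ := fun i => by
    simpa [henonStep] using hR _ (henonStep_mem_nonEscaping_iff.2 (hz i))
  have hy : Tendsto (fun i => (z i).2) l (cobounded ℂ) := by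
    rw [← tendsto_norm_atTop_iff_cobounded, tendsto_atTop]
    intro B
    obtain ⟨M, hM⟩ := (isCompact_closedBall (0 : ℂ) B).exists_bound_of_continuousOn
      (s 0).1.continuous.continuousOn
    have hx' := tendsto_norm_atTop_iff_cobounded.2 hx
    filter_upwards [hx'.eventually_gt_atTop ((M + R + B) / ‖(s 0).2‖)] with i hi
    by_contra! hlt
    rw [div_lt_iff₀ (norm_pos_iff.2 ha)] at hi
    have h1 := hM (z i).2 (by simpa using hlt.le)
    have h2 := norm_sub_norm_le ((s 0).2 * (z i).1) ((s 0).1.eval (z i).2)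
    rw [norm_sub_rev, norm_mul] at h2
    linarith [hw i]
  refine ⟨hy, ?_⟩
  have h1 := (tendsto_eval_div_pow_natDegree (s 0).1).comp hy
  have h2 : Tendsto (fun i => ((s 0).1.eval (z i).2 - (s 0).2 * (z i).1) /
      (z i).2 ^ (s 0).1.natDegree) l (𝓝 0) := by
    have hinv : Tendsto (fun i => ‖(z i).2‖⁻¹) l (𝓝 0) :=
      tendsto_inv_atTop_zero.comp (tendsto_norm_atTop_iff_cobounded.2 hy)
    refine squeeze_zero_norm' (a := fun i => (|R| + 1) * ‖(z i).2‖⁻¹) ?_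
      (by simpa using hinv.const_mul (|R| + 1))
    filter_upwards [(tendsto_norm_atTop_iff_cobounded.2 hy).eventually_ge_atTop 1] with i hi
    have h3 : ‖(z i).2‖ ^ 2 ≤ ‖(z i).2‖ ^ (s 0).1.natDegree :=
      pow_le_pow_right₀ hi (hs.two_le_natDegree 0)
    have h4 : 0 < ‖(z i).2‖ := by linarith
    rw [norm_div, norm_pow, div_le_iff₀ (by positivity)]
    calc _ ≤ |R| * ‖(z i).2‖ + ‖(z i).2‖ := by
          nlinarith [hw i, le_abs_self R, abs_nonneg R]
      _ = (|R| + 1) * ‖(z i).2‖⁻¹ * ‖(z i).2‖ ^ 2 := by field_simp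
      _ ≤ _ := by gcongr
  have h5 := ((h1.sub h2).div_const (s 0).2)
  rw [sub_zero] at h5
  refine h5.congr fun i => ?_
  simp only [Function.comp]
  rw [← sub_div]
  field_simp
  ring

/-- A linear form bounding `c * x` by `ε * x` on the non-escaping set for all `ε` is trivial. -/
lemma eq_zero_of_forall_norm_mul_le {c : ℂ}
    (h : ∀ ε > 0, ∃ B : ℝ, ∀ x : ℂ, ‖c * x‖ ≤ B + ε * ‖x‖) : c = 0 := by
  have : (C c * X).natDegree = 0 := natDegree_eq_zero_of_forall_norm_eval_le (by simpa using h)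
  by_contra hc
  simp [natDegree_C_mul_X _ hc] at this

/-- An affine map preserving the non-escaping set preserves the horizontal direction. -/
lemma eq_zero_of_mapsTo (hs : IsHenonSeq s) {α μ β c γ δ : ℂ}
    (h : ∀ z ∈ nonEscaping s,
      (α * z.1 + μ * z.2 + β, c * z.1 + γ * z.2 + δ) ∈ nonEscaping s) : c = 0 := by
  refine eq_zero_of_forall_norm_mul_le fun ε hε => ?_
  obtain ⟨ε', hε', hle⟩ : ∃ ε' > 0, ε' * (‖α‖ + ‖μ‖ + ‖γ‖) ≤ ε :=
    ⟨ε / (‖α‖ + ‖μ‖ + ‖γ‖ + 1), by positivity, by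
      rw [div_mul_eq_mul_div, div_le_iff₀ (by positivity)]; nlinarith⟩
  obtain ⟨R, hR⟩ := hs.exists_bound one_pos
  obtain ⟨R', hR'⟩ := hs.exists_bound hε'
  refine ⟨‖γ‖ * R' + ‖δ‖ + R' + ε' * (‖μ‖ * R + ‖β‖), fun x => ?_⟩
  obtain ⟨y, hy⟩ := hs.exists_mem_nonEscaping x
  have h1 : ‖c * x‖ ≤ ‖c * x + γ * y + δ‖ + ‖γ‖ * ‖y‖ + ‖δ‖ := by
    have := norm_sub_le (c * x + γ * y + δ - γ * y) δ
    rw [show c * x + γ * y + δ - γ * y - δ = c * x by ring] at this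
    rw [← norm_mul]
    linarith [norm_sub_le (c * x + γ * y + δ) (γ * y)]
  have h2 : ‖α * x + μ * y + β‖ ≤ ‖α‖ * ‖x‖ + ‖μ‖ * ‖y‖ + ‖β‖ := by
    simpa only [norm_mul] using norm_add₃_le (a := α * x) (b := μ * y) (c := β)
  have h3 : ‖c * x + γ * y + δ‖ ≤ R' + ε' * (‖α‖ * ‖x‖ + ‖μ‖ * (R + 1 * ‖x‖) + ‖β‖) :=
    (hR' _ (h _ hy)).trans (by
      gcongr; exact h2.trans (by gcongr; exact hR _ hy))
  have h4 : ‖γ‖ * ‖y‖ ≤ ‖γ‖ * (R' + ε' * ‖x‖) := by gcongr; exact hR' _ hy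
  have h5 := mul_le_mul_of_nonneg_right hle (norm_nonneg x)
  linarith

/-- A translation preserving the non-escaping set is horizontal. -/
lemma translation_eq_zero (hs : IsHenonSeq s) {β δ : ℂ}
    (h : ∀ z ∈ nonEscaping s, (z.1 + β, z.2 + δ) ∈ nonEscaping s) : δ = 0 := by
  obtain ⟨y, hy⟩ := hs.exists_mem_nonEscaping 0
  have hmem : ∀ n : ℕ, (n * β, y + n * δ) ∈ nonEscaping s := by
    intro n
    induction n with
    | zero => simpa using hy
    | succ n ih =>
      convert h _ ih using 2 <;> push_cast <;> ring
  by_contra hδ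
  have hδ' : 0 < ‖δ‖ := norm_pos_iff.2 hδ
  have hε : 0 < ‖δ‖ / (2 * (‖β‖ + 1)) := by positivity
  obtain ⟨R, hR⟩ := hs.exists_bound hε
  obtain ⟨n, hn⟩ := exists_nat_gt ((R + ‖y‖) / (‖δ‖ / 2))
  rw [div_lt_iff₀ (by positivity)] at hn
  have h1 := hR _ (hmem n)
  have h2 : ‖(n : ℂ) * δ‖ ≤ ‖y + n * δ‖ + ‖y‖ := by
    simpa using norm_sub_le (y + n * δ) y
  have h3 : ‖δ‖ / (2 * (‖β‖ + 1)) * ‖β‖ ≤ ‖δ‖ / 2 := by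
    rw [div_mul_eq_mul_div, div_le_div_iff₀ (by positivity) two_pos]
    nlinarith
  have h4 := mul_le_mul_of_nonneg_left h3 n.cast_nonneg
  simp only [norm_mul, RCLike.norm_natCast] at h1 h2
  linarith

/-- If a diagonal affine map preserves the non-escaping set of `s`, its multipliers are related by
the degree of the first factor. -/
lemma pow_natDegree_eq (hs : IsHenonSeq s) {α β γ δ : ℂ} (hα : α ≠ 0) (hγ : γ ≠ 0)
    (h : ∀ z ∈ nonEscaping s, (α * z.1 + β, γ * z.2 + δ) ∈ nonEscaping s) :
    γ ^ (s 0).1.natDegree = α := by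
  choose y hy using hs.exists_mem_nonEscaping
  have haff : ∀ {a : ℂ} (b : ℂ), a ≠ 0 →
      Tendsto (fun x => (a * x + b) / x) (cobounded ℂ) (𝓝 a) := fun {a} b ha => by
    have := (tendsto_inv₀_cobounded (α := ℂ)).const_mul b |>.const_add a
    rw [mul_zero, add_zero] at this
    refine this.congr' ?_
    filter_upwards [eventually_ne_cobounded (0 : ℂ)] with x hx
    field_simp
  have hx' : Tendsto (fun x => α * x + β) (cobounded ℂ) (cobounded ℂ) := by
    have := (C α * X + C β).tendsto_norm_atTop (z := id) (l := cobounded ℂ)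
      (by rw [degree_linear hα]; exact one_pos) tendsto_norm_cobounded_atTop
    simpa [tendsto_norm_atTop_iff_cobounded] using this
  obtain ⟨hy1, h1⟩ := hs.tendsto_of_mem_nonEscaping hy tendsto_id
  obtain ⟨-, h2⟩ := hs.tendsto_of_mem_nonEscaping (fun x => h _ (hy x)) hx'
  have hc : (s 0).1.leadingCoeff / (s 0).2 ≠ 0 := by
    refine div_ne_zero (leadingCoeff_ne_zero.2 fun h0 => ?_) (hs.ne_zero 0)
    simpa [h0] using hs.two_le_natDegree 0
  have h3 := ((haff β hα).mul h1).div (((haff δ hγ).comp hy1).pow (s 0).1.natDegree)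
    (pow_ne_zero _ hγ)
  have h4 : (s 0).1.leadingCoeff / (s 0).2 =
      α * ((s 0).1.leadingCoeff / (s 0).2) / γ ^ (s 0).1.natDegree := by
    refine tendsto_nhds_unique h2 (h3.congr' ?_)
    filter_upwards [eventually_ne_cobounded (0 : ℂ),
      hy1.eventually (eventually_ne_cobounded (0 : ℂ))] with x hx hyx
    simp only [Function.comp, Pi.div_apply]
    rw [div_pow]
    field_simp
  rw [eq_div_iff (pow_ne_zero _ hγ), mul_comm] at h4
  exact mul_right_cancel₀ hc h4

/-- The conjugate by the first factor of a diagonal affine map preserving the non-escaping set is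
again diagonal, with the two multipliers swapped. -/
lemma exists_mapsTo_shift (hs : IsHenonSeq s) {α β γ δ : ℂ}
    (h : ∀ z ∈ nonEscaping s, (α * z.1 + β, γ * z.2 + δ) ∈ nonEscaping s) :
    ∃ δ', ∀ z ∈ nonEscaping (fun k => s (k + 1)),
      (γ * z.1 + δ, α * z.2 + δ') ∈ nonEscaping (fun k => s (k + 1)) := by
  have ha := hs.ne_zero 0
  let q : ℂ[X] := (s 0).1.comp (C γ * X + C δ) - C α * (s 0).1 - C ((s 0).2 * β)
  have hq : ∀ z ∈ nonEscaping (fun k => s (k + 1)),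
      (γ * z.1 + δ, α * z.2 + q.eval z.1) ∈ nonEscaping (fun k => s (k + 1)) := by
    rintro ⟨u, v⟩ hz
    let w : ℂ × ℂ := (((s 0).1.eval u - v) / (s 0).2, u)
    have hw : henonStep (s 0).1 (s 0).2 w = (u, v) := by
      simp only [henonStep, w, Prod.mk.injEq, true_and]
      field_simp
      ring
    rw [← hw, henonStep_mem_nonEscaping_iff] at hz
    convert henonStep_mem_nonEscaping_iff.2 (h w hz) using 1
    simp only [henonStep, w, q, Prod.mk.injEq, true_and, eval_sub, eval_comp, eval_add, eval_mul,
      eval_C, eval_X]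
    field_simp
    ring
  have hdeg : q.natDegree = 0 := by
    refine natDegree_eq_zero_of_forall_norm_eval_le fun ε hε => ?_
    obtain ⟨ε', hε', hle⟩ : ∃ ε' > 0, ε' * (‖α‖ + ‖γ‖) ≤ ε :=
      ⟨ε / (‖α‖ + ‖γ‖ + 1), by positivity, by
        rw [div_mul_eq_mul_div, div_le_iff₀ (by positivity)]; nlinarith⟩
    obtain ⟨R, hR⟩ := hs.shift.exists_bound hε'
    refine ⟨‖α‖ * R + R + ε' * ‖δ‖, fun u => ?_⟩
    obtain ⟨v, hv⟩ := hs.shift.exists_mem_nonEscaping u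
    have h1 : ‖q.eval u‖ ≤ ‖α * v + q.eval u‖ + ‖α‖ * ‖v‖ := by
      rw [← norm_mul]
      simpa using norm_sub_le (α * v + q.eval u) (α * v)
    have h2 : ‖γ * u + δ‖ ≤ ‖γ‖ * ‖u‖ + ‖δ‖ := by
      simpa only [norm_mul] using norm_add_le (γ * u) δ
    have h3 : ‖α * v + q.eval u‖ ≤ R + ε' * (‖γ‖ * ‖u‖ + ‖δ‖) :=
      (hR _ (hq _ hv)).trans (by gcongr)
    have h4 : ‖α‖ * ‖v‖ ≤ ‖α‖ * (R + ε' * ‖u‖) := by gcongr; exact hR _ hv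
    have h5 := mul_le_mul_of_nonneg_right hle (norm_nonneg u)
    linarith
  refine ⟨q.coeff 0, fun z hz => ?_⟩
  have := hq z hz
  rwa [eq_C_of_natDegree_eq_zero hdeg, eval_C] at this

lemma pow_prod_natDegree_eq (hs : IsHenonSeq s) {α β γ δ : ℂ} (hα : α ≠ 0) (hγ : γ ≠ 0)
    (h : ∀ z ∈ nonEscaping s, (α * z.1 + β, γ * z.2 + δ) ∈ nonEscaping s) (n : ℕ) :
    γ ^ (∏ i ∈ Finset.range n, (s i).1.natDegree) = if Even n then γ else α := by
  induction n generalizing s α β γ δ with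
  | zero => simp
  | succ n ih =>
    obtain ⟨δ', hδ'⟩ := hs.exists_mapsTo_shift h
    rw [Finset.prod_range_succ', mul_comm, pow_mul, hs.pow_natDegree_eq hα hγ h,
      ih hs.shift hγ hα hδ']
    simp only [Nat.even_add_one, ite_not]

end IsHenonSeq

namespace GenHenon

/-- The periodic sequence of factors of a generalised Hénon map. -/
def factorSeq (H : GenHenon) (n : ℕ) : ℂ[X] × ℂ :=
  (H.p ⟨n % H.m, Nat.mod_lt _ H.hm⟩, H.a ⟨n % H.m, Nat.mod_lt _ H.hm⟩)

lemma isHenonSeq_factorSeq (H : GenHenon) : IsHenonSeq H.factorSeq where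
  finite_range := (finite_range fun i => (H.p i, H.a i)).subset (by
    rintro _ ⟨n, rfl⟩
    exact ⟨_, rfl⟩)
  two_le_natDegree _ := H.hdeg _
  ne_zero _ := H.ha _

lemma factorSeq_val (H : GenHenon) (i : Fin H.m) : H.factorSeq i = (H.p i, H.a i) := by
  simp [factorSeq, Nat.mod_eq_of_lt i.2]

lemma factorSeq_add_mul (H : GenHenon) (n k : ℕ) :
    H.factorSeq (n + H.m * k) = H.factorSeq n := by
  simp [factorSeq]

lemma foldl_ofFn_henonStep (s : ℕ → ℂ[X] × ℂ) (n : ℕ) (z : ℂ × ℂ) :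
    (List.ofFn fun i : Fin n => henonStep (s i).1 (s i).2).foldl (fun w g => g w) z =
      henonOrbit s n z := by
  induction n with
  | zero => rfl
  | succ n ih =>
    rw [List.ofFn_succ_last, List.foldl_append]
    simpa [henonOrbit] using congrArg (henonStep (s n).1 (s n).2) ih

lemma toFun_eq (H : GenHenon) (z : ℂ × ℂ) : H.toFun z = henonOrbit H.factorSeq H.m z := by
  rw [← foldl_ofFn_henonStep]
  simp [toFun, factorSeq_val]

lemma henonOrbit_factorSeq (H : GenHenon) (k r : ℕ) (z : ℂ × ℂ) :
    henonOrbit H.factorSeq (r + H.m * k) z = henonOrbit H.factorSeq r (H.toFun^[k] z) := by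
  induction k generalizing r with
  | zero => rfl
  | succ k ih =>
    induction r with
    | zero =>
      rw [zero_add, mul_add_one, add_comm, ih, Function.iterate_succ_apply', toFun_eq]
      rfl
    | succ r ihr =>
      rw [add_right_comm, henonOrbit, ihr, factorSeq_add_mul]
      rfl

lemma continuous_henonOrbit (s : ℕ → ℂ[X] × ℂ) (n : ℕ) : Continuous (henonOrbit s n) := by
  induction n with
  | zero => exact continuous_id
  | succ n ih =>
    have : Continuous (henonStep (s n).1 (s n).2) := by
      unfold henonStep
      fun_prop
    exact this.comp ih

lemma Kplus_eq (H : GenHenon) : H.Kplus = nonEscaping H.factorSeq := by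
  ext z
  refine Iff.trans (b := IsBounded (range fun n : ℕ => H.toFun^[n] z)) Iff.rfl ?_
  rw [mem_nonEscaping_iff]
  constructor <;> intro h
  · have hU : IsBounded (⋃ r ∈ Finset.range H.m, henonOrbit H.factorSeq r ''
        closure (range fun n : ℕ => H.toFun^[n] z)) :=
      (isBounded_biUnion_finset _).2 fun r _ =>
        (h.isCompact_closure.image (continuous_henonOrbit _ r)).isBounded
    refine hU.subset ?_
    rintro _ ⟨n, rfl⟩
    refine mem_biUnion (Finset.mem_coe.2 (Finset.mem_range.2 (Nat.mod_lt n H.hm)))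
      ⟨H.toFun^[n / H.m] z, subset_closure ⟨_, rfl⟩, ?_⟩
    rw [← henonOrbit_factorSeq, Nat.mod_add_div]
  · refine h.subset ?_
    rintro _ ⟨n, rfl⟩
    exact ⟨0 + H.m * n, henonOrbit_factorSeq H n 0 z⟩

/-- The generalised Hénon map conjugate to the inverse of `H` by the coordinate swap. -/
def inverse (H : GenHenon) : GenHenon where
  m := H.m
  hm := H.hm
  p i := C (H.a i.rev)⁻¹ * H.p i.rev
  a i := (H.a i.rev)⁻¹
  hdeg i := by
    rw [natDegree_C_mul (inv_ne_zero (H.ha _))]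
    exact H.hdeg _
  ha i := inv_ne_zero (H.ha _)

lemma foldl_ofFn_swap {n : ℕ} (f g : Fin n → ℂ × ℂ → ℂ × ℂ)
    (h : ∀ i z, f i z.swap = (g i z).swap) (z : ℂ × ℂ) :
    (List.ofFn f).foldl (fun w k => k w) z.swap =
      ((List.ofFn g).foldl (fun w k => k w) z).swap := by
  induction n generalizing z with
  | zero => rfl
  | succ n ih =>
    simp only [List.ofFn_succ, List.foldl_cons, h]
    exact ih _ _ (fun i => h i.succ) _

lemma reverse_ofFn {α : Type*} {n : ℕ} (f : Fin n → α) :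
    (List.ofFn f).reverse = List.ofFn fun i => f i.rev := by
  refine List.ext_getElem (by simp) fun i h1 h2 => ?_
  simp only [List.getElem_reverse, List.getElem_ofFn, List.length_ofFn]
  congr 1
  ext
  simp [Fin.val_rev]
  omega

lemma invFun_swap (H : GenHenon) (z : ℂ × ℂ) : H.invFun z.swap = (H.inverse.toFun z).swap := by
  rw [invFun, reverse_ofFn]
  refine foldl_ofFn_swap _ _ (fun i z => ?_) z
  have := H.ha i.rev
  simp only [henonStepInv, henonStep, inverse, Prod.swap, eval_mul, eval_C, Prod.mk.injEq,
    and_true]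
  field_simp

lemma swap_mem_Kminus_iff (H : GenHenon) {z : ℂ × ℂ} :
    z.swap ∈ H.Kminus ↔ z ∈ nonEscaping H.inverse.factorSeq := by
  rw [← Kplus_eq]
  refine Iff.trans (b := IsBounded (range fun n : ℕ => H.invFun^[n] z.swap)) Iff.rfl <|
    Iff.trans ?_ (Iff.rfl (a := IsBounded (range fun n : ℕ => H.inverse.toFun^[n] z)))
  have h : ∀ n : ℕ, H.invFun^[n] z.swap = (H.inverse.toFun^[n] z).swap := fun n =>
    ((show Function.Semiconj Prod.swap H.inverse.toFun H.invFun from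
      fun z => (H.invFun_swap z).symm).iterate_right n z).symm
  simp only [isBounded_iff_forall_norm_le, forall_mem_range, h, Prod.norm_def, Prod.fst_swap,
    Prod.snd_swap, max_comm]

lemma deg_eq (H : GenHenon) :
    H.deg = ∏ i ∈ Finset.range H.m, (H.factorSeq i).1.natDegree := by
  rw [← Fin.prod_univ_eq_prod_range (fun i => (H.factorSeq i).1.natDegree)]
  simp only [factorSeq_val, deg]

lemma deg'_eq (H : GenHenon) :
    H.deg' = ∏ i ∈ Finset.range (H.m - 1), (H.factorSeq i).1.natDegree := by
  have h : H.deg' = ∏ i ∈ Finset.range H.m,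
      if i + 1 < H.m then (H.factorSeq i).1.natDegree else 1 := by
    rw [← Fin.prod_univ_eq_prod_range
      (fun i => if i + 1 < H.m then (H.factorSeq i).1.natDegree else 1)]
    simp only [factorSeq_val, deg']
  obtain ⟨k, hk⟩ := Nat.exists_eq_add_of_lt H.hm
  rw [h, hk, zero_add, Finset.prod_range_succ, if_neg (by omega), mul_one]
  exact Finset.prod_congr rfl fun i hi => if_pos (by simpa using hi)

lemma deg_mul_deg_eq (H : GenHenon) :
    H.deg * H.deg = ∏ i ∈ Finset.range (H.m + H.m), (H.factorSeq i).1.natDegree := by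
  rw [Finset.prod_range_add, deg_eq]
  congr 1
  refine Finset.prod_congr rfl fun i _ => ?_
  rw [add_comm, ← factorSeq_add_mul H i 1, mul_one]

/-- The vertical multiplier of a diagonal affine map preserving `K⁺` is a root of unity of order
dividing `(d + d') * (d - 1)`. -/
lemma multiplier_pow_eq_one (H : GenHenon) {α β γ δ : ℂ} (hα : α ≠ 0) (hγ : γ ≠ 0)
    (h : ∀ z ∈ H.Kplus, (α * z.1 + β, γ * z.2 + δ) ∈ H.Kplus) :
    γ ^ ((H.deg + H.deg') * (H.deg - 1)) = 1 := by
  rw [Kplus_eq] at h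
  have hpow := H.isHenonSeq_factorSeq.pow_prod_natDegree_eq hα hγ h
  have hd := hpow H.m
  have hd' := hpow (H.m - 1)
  have hdd := hpow (H.m + H.m)
  rw [← deg_eq] at hd
  rw [← deg'_eq] at hd'
  rw [← deg_mul_deg_eq, if_pos (Even.add_self _)] at hdd
  have hsub : H.deg - 1 + 1 = H.deg := Nat.sub_add_cancel H.deg_pos
  rcases Nat.even_or_odd H.m with hm | hm
  · rw [if_pos hm] at hd
    have : γ ^ (H.deg - 1) = 1 := mul_right_cancel₀ hγ (by rw [← pow_succ, hsub, hd, one_mul])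
    rw [mul_comm, pow_mul, this, one_pow]
  · rw [if_neg (Nat.not_even_iff_odd.2 hm)] at hd
    rw [if_pos (hm.tsub_odd odd_one)] at hd'
    rw [pow_mul, hd] at hdd
    rw [pow_mul, pow_add, hd, hd']
    refine mul_right_cancel₀ (mul_ne_zero hα hγ) ?_
    rw [← pow_succ, hsub, mul_pow, hdd, hd, one_mul, mul_comm]

/-- An affine automorphism preserving `K⁺` and `K⁻` is diagonal. -/
lemma exists_eq_diagonal (H : GenHenon) {f : ℂ × ℂ → ℂ × ℂ} (hf : IsAffineAut f)
    (hplus : MapsTo f H.Kplus H.Kplus) (hminus : MapsTo f H.Kminus H.Kminus) :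
    ∃ α β γ δ : ℂ, α ≠ 0 ∧ γ ≠ 0 ∧ ∀ z, f z = (α * z.1 + β, γ * z.2 + δ) := by
  obtain ⟨T, b, hT⟩ := hf
  have hlin : ∀ z : ℂ × ℂ, T z = z.1 • T (1, 0) + z.2 • T (0, 1) := fun z => by
    rw [← map_smul, ← map_smul, ← map_add]
    simp
  have hf' : ∀ z, f z = ((T (1, 0)).1 * z.1 + (T (0, 1)).1 * z.2 + b.1,
      (T (1, 0)).2 * z.1 + (T (0, 1)).2 * z.2 + b.2) := fun z => by
    rw [hT, hlin]
    ext <;> simp [mul_comm]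
  rw [Kplus_eq] at hplus
  have h1 : (T (1, 0)).2 = 0 :=
    H.isHenonSeq_factorSeq.eq_zero_of_mapsTo fun z hz => hf' z ▸ hplus hz
  have h2 : (T (0, 1)).1 = 0 := by
    refine H.inverse.isHenonSeq_factorSeq.eq_zero_of_mapsTo (α := (T (0, 1)).2)
      (μ := (T (1, 0)).2) (β := b.2) (γ := (T (1, 0)).1) (δ := b.1) fun z hz => ?_
    have := hminus (H.swap_mem_Kminus_iff.2 hz)
    rw [← H.swap_mem_Kminus_iff]
    convert this using 1
    rw [hf']
    ext <;> simp [add_comm]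
  refine ⟨(T (1, 0)).1, b.1, (T (0, 1)).2, b.2, fun h => ?_, fun h => ?_, fun z => ?_⟩
  · have : T (1, 0) = 0 := Prod.ext h h1
    simp at this
  · have : T (0, 1) = 0 := Prod.ext h2 h
    simp at this
  · rw [hf', h1, h2]
    simp

/-- A diagonal affine map preserving `K⁺` and `K⁻` is determined by its vertical multiplier. -/
lemma diagonal_eq_id (H : GenHenon) {α β δ : ℂ} {f : ℂ × ℂ → ℂ × ℂ} (hα : α ≠ 0)
    (hf : ∀ z, f z = (α * z.1 + β, 1 * z.2 + δ))
    (hplus : MapsTo f H.Kplus H.Kplus) (hminus : MapsTo f H.Kminus H.Kminus) : f = id := by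
  rw [Kplus_eq] at hplus
  have hα1 : α = 1 := by
    rw [← H.isHenonSeq_factorSeq.pow_natDegree_eq hα one_ne_zero fun z hz => hf z ▸ hplus hz,
      one_pow]
  subst hα1
  simp only [one_mul] at hf
  have hδ : δ = 0 :=
    H.isHenonSeq_factorSeq.translation_eq_zero fun z hz => hf z ▸ hplus hz
  have hβ : β = 0 := by
    refine H.inverse.isHenonSeq_factorSeq.translation_eq_zero (β := δ) fun z hz => ?_
    have := hminus (H.swap_mem_Kminus_iff.2 hz)
    rw [hf] at this
    exact H.swap_mem_Kminus_iff.1 this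
  funext z
  simp [hf, hβ, hδ]

end GenHenon

lemma IsAffineAut.comp {f g : ℂ × ℂ → ℂ × ℂ} (hf : IsAffineAut f) (hg : IsAffineAut g) :
    IsAffineAut (f ∘ g) := by
  obtain ⟨T, b, hT⟩ := hf
  obtain ⟨S, c, hS⟩ := hg
  exact ⟨S.trans T, T c + b, fun z => by simp [hT, hS, add_assoc]⟩

lemma IsAffineAut.symm {f : Equiv.Perm (ℂ × ℂ)} (hf : IsAffineAut f) : IsAffineAut f.symm := by
  obtain ⟨T, b, hT⟩ := hf
  refine ⟨T.symm, -T.symm b, fun z => ?_⟩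
  rw [Equiv.symm_apply_eq, hT]
  simp

lemma IsAffineAut.differentiable {f : ℂ × ℂ → ℂ × ℂ} (hf : IsAffineAut f) :
    Differentiable ℂ f := by
  obtain ⟨T, b, hT⟩ := hf
  have h : f = fun z => T.toContinuousLinearEquiv z + b := funext hT
  rw [h]
  fun_prop

namespace GenHenon

/-- The group of affine automorphisms preserving `K⁺` and `K⁻`. -/
def affineStabilizer (H : GenHenon) : Subgroup (Equiv.Perm (ℂ × ℂ)) where
  carrier := {f | IsAffineAut f ∧ ⇑f '' H.Kplus = H.Kplus ∧ ⇑f '' H.Kminus = H.Kminus}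
  one_mem' := ⟨⟨LinearEquiv.refl ℂ _, 0, fun z => by simp⟩, by simp, by simp⟩
  mul_mem' := by
    rintro f g ⟨hf, hf1, hf2⟩ ⟨hg, hg1, hg2⟩
    refine ⟨hf.comp hg, ?_, ?_⟩
    · rw [Equiv.Perm.coe_mul, image_comp, hg1, hf1]
    · rw [Equiv.Perm.coe_mul, image_comp, hg2, hf2]
  inv_mem' := by
    rintro f ⟨hf, hf1, hf2⟩
    refine ⟨hf.symm, ?_, ?_⟩
    · conv_lhs => rw [← hf1]
      exact f.symm_image_image _
    · conv_lhs => rw [← hf2]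
      exact f.symm_image_image _

lemma mem_affineStabilizer {H : GenHenon} {f : Equiv.Perm (ℂ × ℂ)} :
    f ∈ H.affineStabilizer ↔
      IsAffineAut f ∧ ⇑f '' H.Kplus = H.Kplus ∧ ⇑f '' H.Kminus = H.Kminus :=
  Iff.rfl

lemma exists_diagonal_of_mem {H : GenHenon} {f : Equiv.Perm (ℂ × ℂ)}
    (hf : f ∈ H.affineStabilizer) :
    ∃ α β γ δ : ℂ, α ≠ 0 ∧ γ ≠ 0 ∧ ∀ z, f z = (α * z.1 + β, γ * z.2 + δ) :=
  H.exists_eq_diagonal hf.1 (mapsTo_iff_image_subset.2 hf.2.1.subset)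
    (mapsTo_iff_image_subset.2 hf.2.2.subset)

/-- The multiplier of an affine symmetry in the vertical direction. -/
def verticalMultiplier (H : GenHenon) : H.affineStabilizer →* ℂ where
  toFun f := (f.1 (0, 1)).2 - (f.1 (0, 0)).2
  map_one' := by simp
  map_mul' f g := by
    obtain ⟨α, β, γ, δ, -, -, hf⟩ := exists_diagonal_of_mem f.2
    obtain ⟨α', β', γ', δ', -, -, hg⟩ := exists_diagonal_of_mem g.2
    simp only [Subgroup.coe_mul, Equiv.Perm.mul_apply, hf, hg]
    ring

lemma verticalMultiplier_pow (H : GenHenon) (f : H.affineStabilizer) :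
    H.verticalMultiplier f ^ ((H.deg + H.deg') * (H.deg - 1)) = 1 := by
  obtain ⟨α, β, γ, δ, hα, hγ, hf⟩ := exists_diagonal_of_mem f.2
  have : H.verticalMultiplier f = γ := by simp [verticalMultiplier, hf]
  rw [this]
  exact H.multiplier_pow_eq_one hα hγ fun z hz =>
    hf z ▸ mapsTo_iff_image_subset.2 f.2.2.1.subset hz

lemma verticalMultiplier_injective (H : GenHenon) : Function.Injective H.verticalMultiplier := by
  rw [injective_iff_map_eq_one]
  intro f h
  obtain ⟨α, β, γ, δ, hα, hγ, hf⟩ := exists_diagonal_of_mem f.2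
  have hγ1 : γ = 1 := by
    rw [← h]
    simp [verticalMultiplier, hf]
  subst hγ1
  have := H.diagonal_eq_id hα hf (mapsTo_iff_image_subset.2 f.2.2.1.subset)
    (mapsTo_iff_image_subset.2 f.2.2.2.subset)
  exact Subtype.ext (DFunLike.coe_injective this)

end GenHenon
/-- The set `𝓛` of affine automorphisms of `ℂ²` preserving both `K⁺` and `K⁻` of a
generalised Hénon map of degree `d ≥ 2` is a subgroup of `Aut(ℂ²)` under composition; it is
finite and isomorphic to a subgroup of the cyclic group `ℤ/((d+d')(d-1))ℤ`; in particular it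
is cyclic and its order divides `(d+d')·(d-1)`. -/
theorem affine_preserving_group_is_cyclic (H : GenHenon) (hd : 2 ≤ H.deg) :
    ∃ 𝓛 : Subgroup (Equiv.Perm (ℂ × ℂ)),
      (∀ f : Equiv.Perm (ℂ × ℂ), f ∈ 𝓛 ↔
        (IsAffineAut f ∧ ⇑f '' H.Kplus = H.Kplus ∧ ⇑f '' H.Kminus = H.Kminus)) ∧
      𝓛 ≤ autC2Group ∧
      Finite ↥𝓛 ∧
      (∃ φ : ↥𝓛 →* Multiplicative (ZMod ((H.deg + H.deg') * (H.deg - 1))),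
        Function.Injective φ) ∧
      IsCyclic ↥𝓛 ∧ Nat.card ↥𝓛 ∣ (H.deg + H.deg') * (H.deg - 1) := by
  have : NeZero ((H.deg + H.deg') * (H.deg - 1)) :=
    ⟨Nat.mul_ne_zero (by omega) (by omega)⟩
  generalize hN : (H.deg + H.deg') * (H.deg - 1) = N at this
  have hroot : ∀ f, H.verticalMultiplier.toHomUnits f ∈ rootsOfUnity N ℂ := fun f => by
    rw [mem_rootsOfUnity', MonoidHom.coe_toHomUnits, ← hN, H.verticalMultiplier_pow]
  let ψ := H.verticalMultiplier.toHomUnits.codRestrict (rootsOfUnity N ℂ) hroot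
  have hcard : Nat.card (rootsOfUnity N ℂ) = Nat.card (Multiplicative (ZMod N)) := by
    rw [Complex.card_rootsOfUnity]
    simp
  let φ := (mulEquivOfCyclicCardEq hcard).toMonoidHom.comp ψ
  have hφ : Function.Injective φ := by
    refine (mulEquivOfCyclicCardEq hcard).injective.comp fun f g hfg => ?_
    exact H.verticalMultiplier_injective
      (congrArg (fun u : rootsOfUnity N ℂ => ((u : ℂˣ) : ℂ)) hfg)
  refine ⟨H.affineStabilizer, fun f => Iff.rfl,
    fun f hf => ⟨hf.1.differentiable, hf.1.symm.differentiable⟩, Finite.of_injective φ hφ,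
    ⟨φ, hφ⟩, isCyclic_of_injective φ hφ, ?_⟩
  simpa using Subgroup.card_dvd_of_injective φ hφ
end
end

section
/- Let H be a generalised Hénon map with each p_i monic, and let x₀ ∈ U⁺. Then the fundamental group π₁(U⁺, x₀) is isomorphic to the additive group ℤ[1/d]. Moreover the isomorphism α : π₁(U⁺, x₀) → ℤ[1/d] can be chosen so that for every path σ in U⁺ from x₀ to H(x₀) and every loop γ in U⁺ based at x₀, one has α([σ · (H∘γ) · σ⁻¹]) = d · α([γ]), where σ · (H∘γ) · σ⁻¹ denotes the loop at x₀ obtained by concatenating σ, the image loop H∘γ based at H(x₀), and the reverse of σ. -/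
noncomputable section

open Complex Filter Set Topology

/-- The additive subgroup `ℤ[1/d] = {k/dⁿ : k ∈ ℤ, n ∈ ℕ}` of `ℚ`. -/
def zdInv (d : ℕ) (hd : 0 < d) : AddSubgroup ℚ where
  carrier := {q | ∃ (k : ℤ) (n : ℕ), q = (k : ℚ) / (d : ℚ) ^ n}
  zero_mem' := ⟨0, 0, by simp⟩
  add_mem' := by
    rintro x y ⟨k, n, rfl⟩ ⟨k', n', rfl⟩
    refine ⟨k * (d : ℤ) ^ n' + k' * (d : ℤ) ^ n, n + n', ?_⟩
    have hd0 : (d : ℚ) ≠ 0 := Nat.cast_ne_zero.mpr hd.ne'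
    have h1 : (d : ℚ) ^ n ≠ 0 := pow_ne_zero _ hd0
    have h2 : (d : ℚ) ^ n' ≠ 0 := pow_ne_zero _ hd0
    rw [div_add_div _ _ h1 h2, pow_add]
    push_cast
    ring
  neg_mem' := by
    rintro x ⟨k, n, rfl⟩
    exact ⟨-k, n, by push_cast; ring⟩

attribute [local instance] Path.Homotopic.setoid

/-- `FundamentalGroup.fromPath` for an arbitrary topological space. -/
def fgFromPath {Y : Type*} [TopologicalSpace Y] {y : Y}
    (p : Path.Homotopic.Quotient y y) : FundamentalGroup Y y :=
  FundamentalGroup.fromPath (X := TopCat.of Y) p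

/-- `f = exp ∘ w` for a continuous `w` whose total increment is `c`. -/
def HasLogIncrement (f : unitInterval → ℂ) (c : ℂ) : Prop :=
  ∃ w : unitInterval → ℂ, Continuous w ∧ (∀ t, exp (w t) = f t) ∧ w 1 - w 0 = c

namespace HasLogIncrement

lemma exp_eq_one {f : unitInterval → ℂ} {c : ℂ} (h : HasLogIncrement f c) (h01 : f 0 = f 1) :
    exp c = 1 := by
  obtain ⟨w, -, hw, rfl⟩ := h
  rw [exp_sub, hw, hw, h01, div_self]
  rw [← hw]
  exact exp_ne_zero _

lemma of_continuous {f : unitInterval → ℂ} (hf : Continuous f) (h0 : ∀ t, f t ≠ 0) :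
    ∃ c, HasLogIncrement f c := by
  let F : C(unitInterval, {z : ℂ // z ≠ 0}) := ⟨fun t => ⟨f t, h0 t⟩, by fun_prop⟩
  obtain ⟨Γ, hΓ, -⟩ := isCoveringMap_exp.exists_path_lifts F (Complex.log (f 0))
    (Subtype.ext (Complex.exp_log (h0 0)).symm)
  exact ⟨_, Γ, Γ.continuous, fun t => congrArg Subtype.val (congrFun hΓ t), rfl⟩

lemma unique {f : unitInterval → ℂ} {c c' : ℂ} (h : HasLogIncrement f c)
    (h' : HasLogIncrement f c') : c = c' := by
  obtain ⟨w, hwc, hw, rfl⟩ := h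
  obtain ⟨v, hvc, hv, rfl⟩ := h'
  have key := isCoveringMap_exp.eq_of_comp_eq (g₁ := w) (g₂ := fun t => v t + (w 0 - v 0)) hwc
    (by fun_prop) (by
      ext t
      simp only [Function.comp_apply, exp_add, exp_sub, hw, hv]
      rw [div_self, mul_one]
      rw [← hv]
      exact exp_ne_zero _) 0 (by simp)
  rw [congrFun key 1]
  ring

lemma pow {f : unitInterval → ℂ} {c : ℂ} (h : HasLogIncrement f c) (n : ℕ) :
    HasLogIncrement (fun t => f t ^ n) (n * c) := by
  obtain ⟨w, hwc, hw, rfl⟩ := h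
  exact ⟨fun t => n * w t, by fun_prop, fun t => by rw [exp_nat_mul, hw], by ring⟩

lemma of_norm_sub_lt {f g : unitInterval → ℂ} {c : ℂ} (h : HasLogIncrement f c) (hg : Continuous g)
    (hlt : ∀ t, ‖g t - f t‖ < ‖f t‖) (hf01 : f 0 = f 1) (hg01 : g 0 = g 1) :
    HasLogIncrement g c := by
  obtain ⟨w, hwc, hw, rfl⟩ := h
  have hf0 : ∀ t, f t ≠ 0 := fun t => by rw [← hw]; exact exp_ne_zero _
  have hfc : Continuous f := by
    rw [← funext hw]
    fun_prop
  have hs : ∀ t, g t / f t ∈ slitPlane := fun t => by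
    have h1 : ‖(g t - f t) / f t‖ < 1 := by
      rw [norm_div, div_lt_one (norm_pos_iff.2 (hf0 t))]
      exact hlt t
    have h2 := mem_slitPlane_of_norm_lt_one h1
    rwa [sub_div, div_self (hf0 t), add_sub_cancel] at h2
  refine ⟨fun t => w t + Complex.log (g t / f t),
    hwc.add ((hg.div hfc hf0).clog hs), fun t => ?_, ?_⟩
  · rw [exp_add, hw, exp_log (slitPlane_ne_zero (hs t)), mul_div_cancel₀ _ (hf0 t)]
  · simp only [hf01, hg01]
    ring

lemma path_trans {X : Type*} [TopologicalSpace X] {x y z : X} (g : X → ℂ) (γ : Path x y)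
    (δ : Path y z) {c c' : ℂ} (h : HasLogIncrement (fun t => g (γ t)) c)
    (h' : HasLogIncrement (fun t => g (δ t)) c') :
    HasLogIncrement (fun t => g (γ.trans δ t)) (c + c') := by
  obtain ⟨w, hwc, hw, rfl⟩ := h
  obtain ⟨v, hvc, hv, rfl⟩ := h'
  simp only at hw hv
  let p : Path (w 0) (w 1) := ⟨⟨w, hwc⟩, rfl, rfl⟩
  let q : Path (w 1) (v 1 + (w 1 - v 0)) :=
    ⟨⟨fun t => v t + (w 1 - v 0), by fun_prop⟩, by simp, rfl⟩
  have hq : ∀ t, exp (q t) = g (δ t) := fun t => by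
    change exp (v t + (w 1 - v 0)) = _
    rw [exp_add, exp_sub, hv, hw, hv, γ.target, δ.source, div_self, mul_one]
    rw [← δ.source, ← hv]
    exact exp_ne_zero _
  refine ⟨p.trans q, (p.trans q).continuous, fun t => ?_, ?_⟩
  · simp only [Path.trans_apply]
    split_ifs
    · exact hw _
    · exact hq _
  · rw [Path.target, Path.source]
    ring

lemma path_symm {X : Type*} [TopologicalSpace X] {x y : X} (g : X → ℂ) (γ : Path x y)
    {c : ℂ} (h : HasLogIncrement (fun t => g (γ t)) c) :
    HasLogIncrement (fun t => g (γ.symm t)) (-c) := by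
  obtain ⟨w, hwc, hw, rfl⟩ := h
  exact ⟨fun t => w (unitInterval.symm t), by fun_prop, fun t => hw _, by simp⟩

lemma of_homotopy {G : unitInterval × unitInterval → ℂ} (hG : Continuous G) (h0 : ∀ p, G p ≠ 0)
    (hs : ∀ s, G (s, 0) = G (0, 0)) (ht : ∀ s, G (s, 1) = G (0, 1)) {c : ℂ}
    (h : HasLogIncrement (fun t => G (0, t)) c) : HasLogIncrement (fun t => G (1, t)) c := by
  obtain ⟨w, hwc, hw, rfl⟩ := h
  let F : C(unitInterval × unitInterval, {z : ℂ // z ≠ 0}) := ⟨fun p => ⟨G p, h0 p⟩, by fun_prop⟩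
  have H0 : ∀ t, F (0, t) = (⟨exp (w t), exp_ne_zero _⟩ : {z : ℂ // z ≠ 0}) :=
    fun t => Subtype.ext (hw t).symm
  let W := isCoveringMap_exp.liftHomotopy F ⟨w, hwc⟩ H0
  have hW : ∀ p, exp (W p) = G p := fun p =>
    congrArg Subtype.val (congrFun (isCoveringMap_exp.liftHomotopy_lifts F ⟨w, hwc⟩ H0) p)
  have hW0 : ∀ t, W (0, t) = w t := fun t =>
    isCoveringMap_exp.liftHomotopy_zero F ⟨w, hwc⟩ H0 t
  have const : ∀ u, (∀ s, G (s, u) = G (0, u)) → W (1, u) = W (0, u) := fun u hu => by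
    have h1 : HasLogIncrement (fun _ => G (0, u)) (W (1, u) - W (0, u)) :=
      ⟨fun s => W (s, u), by fun_prop, fun s => by rw [hW, hu], rfl⟩
    have h2 : HasLogIncrement (fun _ => G (0, u)) 0 :=
      ⟨fun _ => W (0, u), by fun_prop, fun s => by rw [hW], by simp⟩
    exact sub_eq_zero.1 (h1.unique h2)
  refine ⟨fun t => W (1, t), by fun_prop, fun t => hW _, ?_⟩
  simp only
  rw [const 0 hs, const 1 ht, hW0, hW0]

end HasLogIncrement

/-- The region `{|y| > max(|x|, R)}`. -/
def escapeRegion (R : ℝ) : Set (ℂ × ℂ) := {z | R < ‖z.2‖ ∧ ‖z.1‖ < ‖z.2‖}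

lemma isOpen_escapeRegion (R : ℝ) : IsOpen (escapeRegion R) :=
  (isOpen_lt continuous_const continuous_snd.norm).inter
    (isOpen_lt continuous_fst.norm continuous_snd.norm)

/-- A continuous map which preserves `escapeRegion R`, expands the second coordinate there by at
least `2 ^ k`, and multiplies the winding number of the second coordinate of a loop by `n`. -/
structure IsEscapeMap (R : ℝ) (k n : ℕ) (g : ℂ × ℂ → ℂ × ℂ) : Prop where
  continuous : Continuous g
  mapsTo : MapsTo g (escapeRegion R) (escapeRegion R)
  growth : ∀ z ∈ escapeRegion R, 2 ^ k * ‖z.2‖ ≤ ‖(g z).2‖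
  mem_or_norm_le : ∀ z, g z ∈ escapeRegion R ∨ ‖g z‖ ≤ max ‖z‖ R
  hasLogIncrement : ∀ φ : unitInterval → ℂ × ℂ, Continuous φ → (∀ t, φ t ∈ escapeRegion R) →
    φ 0 = φ 1 → ∀ c, HasLogIncrement (fun t => (φ t).2) c → HasLogIncrement (fun t => (g (φ t)).2) (n * c)

namespace IsEscapeMap

lemma id (R : ℝ) : IsEscapeMap R 0 1 (fun z => z) where
  continuous := continuous_id
  mapsTo := fun _ hz => hz
  growth := fun z _ => by simp
  mem_or_norm_le := fun z => Or.inr (le_max_left _ _)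
  hasLogIncrement := fun φ _ _ _ c hc => by simpa using hc

lemma comp {R : ℝ} {k k' n n' : ℕ} {g h : ℂ × ℂ → ℂ × ℂ} (hh : IsEscapeMap R k' n' h)
    (hg : IsEscapeMap R k n g) : IsEscapeMap R (k' + k) (n' * n) (fun z => h (g z)) where
  continuous := hh.continuous.comp hg.continuous
  mapsTo := hh.mapsTo.comp hg.mapsTo
  growth := fun z hz => by
    refine le_trans ?_ (hh.growth _ (hg.mapsTo hz))
    rw [pow_add, mul_assoc]
    gcongr
    exact hg.growth z hz
  mem_or_norm_le := fun z => by
    rcases hh.mem_or_norm_le (g z) with h1 | h1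
    · exact Or.inl h1
    rcases hg.mem_or_norm_le z with h2 | h2
    · exact Or.inl (hh.mapsTo h2)
    · exact Or.inr (h1.trans (max_le h2 (le_max_right _ _)))
  hasLogIncrement := fun φ hφ hV h01 c hc => by
    have := hh.hasLogIncrement (fun t => g (φ t)) (hg.continuous.comp hφ)
      (fun t => hg.mapsTo (hV t)) (by simp only [h01]) _ (hg.hasLogIncrement φ hφ hV h01 c hc)
    rwa [← mul_assoc, ← Nat.cast_mul] at this

lemma foldl_ofFn {R : ℝ} : ∀ {m : ℕ} {g : Fin m → ℂ × ℂ → ℂ × ℂ} {n : Fin m → ℕ},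
    (∀ i, IsEscapeMap R 1 (n i) (g i)) →
    IsEscapeMap R m (∏ i, n i) (fun z => (List.ofFn g).foldl (fun w g => g w) z)
  | 0, _, _, _ => by simpa using id R
  | m + 1, g, n, h => by
    have := (foldl_ofFn fun i : Fin m => h i.succ).comp (h 0)
    simpa [Fin.prod_univ_succ, mul_comm] using this

/-- The iterates of `z` eventually escape if they are unbounded. -/
lemma exists_iterate_mem {R : ℝ} {k n : ℕ} {g : ℂ × ℂ → ℂ × ℂ} (h : IsEscapeMap R k n g)
    {z : ℂ × ℂ} (hz : ¬ Bornology.IsBounded (range fun j : ℕ => g^[j] z)) :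
    ∃ j, g^[j] z ∈ escapeRegion R := by
  by_contra! hcon
  refine hz ((Metric.isBounded_closedBall (x := (0 : ℂ × ℂ)) (r := max ‖z‖ R)).subset ?_)
  rintro _ ⟨j, rfl⟩
  rw [mem_closedBall_zero_iff]
  induction j with
  | zero => exact le_max_left _ _
  | succ j ih =>
    have h1 := (h.mem_or_norm_le (g^[j] z)).resolve_left
      (by simpa only [Function.iterate_succ_apply'] using hcon (j + 1))
    simp only [Function.iterate_succ_apply']
    exact h1.trans (max_le ih (le_max_right _ _))

lemma iterate_mem_of_le {R : ℝ} {k n : ℕ} {g : ℂ × ℂ → ℂ × ℂ} (h : IsEscapeMap R k n g)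
    {z : ℂ × ℂ} {i j : ℕ} (hij : i ≤ j) (hz : g^[i] z ∈ escapeRegion R) :
    g^[j] z ∈ escapeRegion R := by
  obtain ⟨l, rfl⟩ := Nat.exists_eq_add_of_le' hij
  rw [Function.iterate_add_apply]
  exact h.mapsTo.iterate l hz

lemma not_isBounded_of_iterate_mem {R : ℝ} (hR : 0 ≤ R) {k n : ℕ} (hk : 0 < k)
    {g : ℂ × ℂ → ℂ × ℂ} (h : IsEscapeMap R k n g) {z : ℂ × ℂ} {i : ℕ}
    (hz : g^[i] z ∈ escapeRegion R) : ¬ Bornology.IsBounded (range fun j : ℕ => g^[j] z) := by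
  intro hb
  obtain ⟨C, hC⟩ := hb.exists_norm_le
  have hpos : 0 < ‖(g^[i] z).2‖ := hR.trans_lt hz.1
  have hgrow : ∀ l : ℕ, 2 ^ l * ‖(g^[i] z).2‖ ≤ ‖(g^[l + i] z).2‖ := fun l => by
    induction l with
    | zero => simp
    | succ l ih =>
      have h1 : 2 ^ k * ‖(g^[l + i] z).2‖ ≤ ‖(g^[(l + i).succ] z).2‖ := by
        rw [Function.iterate_succ_apply']
        exact h.growth _ (h.iterate_mem_of_le (Nat.le_add_left i l) hz)
      have h2 : (2 : ℝ) ^ 1 ≤ 2 ^ k := pow_le_pow_right₀ one_le_two hk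
      calc (2 : ℝ) ^ (l + 1) * ‖(g^[i] z).2‖ = 2 ^ 1 * (2 ^ l * ‖(g^[i] z).2‖) := by ring
        _ ≤ 2 ^ k * ‖(g^[l + i] z).2‖ := by gcongr
        _ ≤ _ := by rwa [show l + 1 + i = (l + i).succ by omega]
  obtain ⟨l, hl⟩ := pow_unbounded_of_one_lt (C / ‖(g^[i] z).2‖) one_lt_two
  have h1 := (hgrow l).trans ((norm_snd_le _).trans (hC _ ⟨l + i, rfl⟩))
  rw [div_lt_iff₀ hpos] at hl
  linarith

end IsEscapeMap

lemma Polynomial.Monic.exists_norm_eval_sub_le {p : Polynomial ℂ} (hp : p.Monic) :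
    ∃ C : ℝ, 0 ≤ C ∧ ∀ y : ℂ, 1 ≤ ‖y‖ →
      ‖p.eval y - y ^ p.natDegree‖ ≤ C * ‖y‖ ^ (p.natDegree - 1) := by
  refine ⟨∑ i ∈ Finset.range p.natDegree, ‖p.coeff i‖, by positivity, fun y hy => ?_⟩
  rw [Polynomial.eval_eq_sum_range, Finset.sum_range_succ, hp.coeff_natDegree, one_mul,
    add_sub_cancel_right, Finset.sum_mul]
  refine (norm_sum_le _ _).trans (Finset.sum_le_sum fun i hi => ?_)
  rw [norm_mul, norm_pow]
  have := Finset.mem_range.1 hi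
  exact mul_le_mul_of_nonneg_left (pow_le_pow_right₀ hy (by omega)) (norm_nonneg _)

lemma exists_isEscapeMap_henonStep {p : Polynomial ℂ} (hp : p.Monic) (hd : 2 ≤ p.natDegree)
    (a : ℂ) : ∃ R₀ : ℝ, 0 ≤ R₀ ∧ ∀ R ≥ R₀, IsEscapeMap R 1 p.natDegree (henonStep p a) := by
  obtain ⟨C, hC0, hC⟩ := hp.exists_norm_eval_sub_le
  have ha := norm_nonneg a
  refine ⟨2 * (C + ‖a‖) + 4, by positivity, fun R hR => ?_⟩
  have key : ∀ z ∈ escapeRegion R,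
      ‖p.eval z.2 - a * z.1 - z.2 ^ p.natDegree‖ ≤ ‖z.2‖ ^ p.natDegree / 2 ∧
      4 * ‖z.2‖ ≤ ‖z.2‖ ^ p.natDegree := by
    rintro ⟨x, y⟩ ⟨hy, hxy⟩
    simp only at hy hxy ⊢
    have hy4 : 4 ≤ ‖y‖ := by linarith
    have hpow : ‖y‖ ≤ ‖y‖ ^ (p.natDegree - 1) := le_self_pow₀ (by linarith) (by omega)
    have hsucc : ‖y‖ ^ p.natDegree = ‖y‖ ^ (p.natDegree - 1) * ‖y‖ := by
      rw [← pow_succ]; congr 1; omega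
    constructor
    · calc ‖p.eval y - a * x - y ^ p.natDegree‖
          = ‖(p.eval y - y ^ p.natDegree) - a * x‖ := by congr 1; ring
        _ ≤ ‖p.eval y - y ^ p.natDegree‖ + ‖a * x‖ := norm_sub_le _ _
        _ ≤ C * ‖y‖ ^ (p.natDegree - 1) + ‖a‖ * ‖y‖ ^ (p.natDegree - 1) := by
          rw [norm_mul]
          gcongr
          · exact hC y (by linarith)
          · exact hxy.le.trans hpow
        _ = ‖y‖ ^ (p.natDegree - 1) * (C + ‖a‖) := by ring
        _ ≤ ‖y‖ ^ (p.natDegree - 1) * (‖y‖ / 2) := by gcongr; linarith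
        _ = ‖y‖ ^ p.natDegree / 2 := by rw [hsucc]; ring
    · rw [hsucc]
      nlinarith
  have grow : ∀ z ∈ escapeRegion R, 2 * ‖z.2‖ ≤ ‖p.eval z.2 - a * z.1‖ := fun z hz => by
    obtain ⟨h1, h2⟩ := key z hz
    have h3 := norm_sub_norm_le (z.2 ^ p.natDegree) (z.2 ^ p.natDegree - (p.eval z.2 - a * z.1))
    rw [norm_sub_rev (z.2 ^ p.natDegree) (p.eval z.2 - a * z.1), sub_sub_cancel, norm_pow] at h3
    linarith
  have hcont : Continuous (henonStep p a) := by
    unfold henonStep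
    have := p.continuous
    fun_prop
  refine ⟨hcont, fun z hz => ?_, fun z hz => by simpa [henonStep] using grow z hz, fun z => ?_,
    fun φ hφ hV h01 c hc => ?_⟩
  · have h1 := grow z hz
    have h2 := hz.1
    exact ⟨by simp only [henonStep]; linarith, by simp only [henonStep]; linarith⟩
  · by_cases h : henonStep p a z ∈ escapeRegion R
    · exact Or.inl h
    · refine Or.inr (max_le ((norm_snd_le z).trans (le_max_left _ _)) ?_)
      by_contra! hlt
      refine h ⟨(le_max_right _ _).trans_lt hlt, ?_⟩
      exact ((norm_snd_le z).trans (le_max_left _ _)).trans_lt hlt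
  · refine (hc.pow p.natDegree).of_norm_sub_lt (continuous_snd.comp (hcont.comp hφ))
      (fun t => ?_) (by simp only [h01]) (by simp only [h01])
    obtain ⟨h1, h2⟩ := key _ (hV t)
    have h3 : 0 < ‖(φ t).2‖ := (norm_nonneg _).trans_lt (hV t).2
    refine h1.trans_lt ?_
    rw [norm_pow]
    linarith

lemma henonStep_henonStepInv {p : Polynomial ℂ} {a : ℂ} (ha : a ≠ 0) (z : ℂ × ℂ) :
    henonStep p a (henonStepInv p a z) = z := by
  ext
  · rfl
  · simp [henonStep, henonStepInv, mul_div_cancel₀ _ ha]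

lemma henonStepInv_henonStep {p : Polynomial ℂ} {a : ℂ} (ha : a ≠ 0) (z : ℂ × ℂ) :
    henonStepInv p a (henonStep p a z) = z := by
  ext
  · simp [henonStep, henonStepInv, mul_div_cancel_left₀ _ ha]
  · rfl

lemma continuous_henonStepInv (p : Polynomial ℂ) (a : ℂ) : Continuous (henonStepInv p a) := by
  unfold henonStepInv
  have := p.continuous
  fun_prop

lemma List.foldl_ofFn_foldr_ofFn {X : Type*} : ∀ {m : ℕ} {g h : Fin m → X → X},
    (∀ i, Function.RightInverse (h i) (g i)) → ∀ x,
    (List.ofFn g).foldl (fun w g => g w) ((List.ofFn h).foldr (fun g w => g w) x) = x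
  | 0, _, _, _, _ => by simp
  | m + 1, g, h, hgh, x => by
    simp only [List.ofFn_succ, List.foldl_cons, List.foldr_cons]
    rw [hgh 0]
    exact foldl_ofFn_foldr_ofFn (fun i => hgh i.succ) x

lemma List.foldr_ofFn_foldl_ofFn {X : Type*} : ∀ {m : ℕ} {g h : Fin m → X → X},
    (∀ i, Function.LeftInverse (h i) (g i)) → ∀ x,
    (List.ofFn h).foldr (fun g w => g w) ((List.ofFn g).foldl (fun w g => g w) x) = x
  | 0, _, _, _, _ => by simp
  | m + 1, g, h, hgh, x => by
    simp only [List.ofFn_succ, List.foldl_cons, List.foldr_cons]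
    rw [foldr_ofFn_foldl_ofFn (fun i => hgh i.succ)]
    exact hgh 0 x

lemma List.continuous_foldr_ofFn {X : Type*} [TopologicalSpace X] : ∀ {m : ℕ}
    {h : Fin m → X → X}, (∀ i, Continuous (h i)) →
    Continuous fun x => (List.ofFn h).foldr (fun g w => g w) x
  | 0, _, _ => by simpa using continuous_id'
  | m + 1, h, hh => by
    simp only [List.ofFn_succ, List.foldr_cons]
    exact (hh 0).comp (continuous_foldr_ofFn fun i => hh i.succ)

namespace GenHenon

variable (H : GenHenon)

lemma toFun_invFun : Function.RightInverse H.invFun H.toFun := fun z => by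
  simp only [toFun, invFun, List.foldl_reverse]
  exact List.foldl_ofFn_foldr_ofFn (fun i => henonStep_henonStepInv (H.ha i)) z

lemma invFun_toFun : Function.LeftInverse H.invFun H.toFun := fun z => by
  simp only [toFun, invFun, List.foldl_reverse]
  exact List.foldr_ofFn_foldl_ofFn (fun i => henonStepInv_henonStep (H.ha i)) z

lemma continuous_invFun : Continuous H.invFun := by
  unfold invFun
  simp only [List.foldl_reverse]
  exact List.continuous_foldr_ofFn fun i => continuous_henonStepInv _ _

lemma exists_isEscapeMap (hmonic : ∀ i, (H.p i).Monic) :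
    ∃ R : ℝ, 0 ≤ R ∧ IsEscapeMap R H.m H.deg H.toFun := by
  choose R₀ h0 hR₀ using fun i => exists_isEscapeMap_henonStep (hmonic i) (H.hdeg i) (H.a i)
  refine ⟨∑ i, R₀ i, Finset.sum_nonneg fun i _ => h0 i, ?_⟩
  exact IsEscapeMap.foldl_ofFn fun i => hR₀ i _
    (Finset.single_le_sum (fun j _ => h0 j) (Finset.mem_univ i))

end GenHenon

lemma Path.homotopic_refl_of_factors {X S : Type*} [TopologicalSpace X] [TopologicalSpace S]
    [SimplyConnectedSpace S] {x : X} {s : S} (Φ : C(S, X)) (l : Path s s) (γ : Path x x)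
    (h : ∀ t, γ t = Φ (l t)) : γ.Homotopic (Path.refl x) := by
  obtain rfl : Φ s = x := by rw [← γ.source, h, l.source]
  have h1 := (SimplyConnectedSpace.paths_homotopic l (Path.refl s)).map Φ
  have h2 : l.map Φ.continuous = γ := Path.ext (funext fun t => (h t).symm)
  rw [h2] at h1
  exact h1

/-- The universal cover of `escapeRegion R`: it is covered by `(s, w) ↦ (s eʷ, eʷ)`. -/
def escapeCover (R : ℝ) : Set (ℂ × ℂ) := {q | ‖q.1‖ < 1 ∧ R < Real.exp q.2.re}

/-- The covering map `(s, w) ↦ (s eʷ, eʷ)` of `escapeRegion R` by `escapeCover R`. -/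
def escapeCoverMap (q : ℂ × ℂ) : ℂ × ℂ := (q.1 * exp q.2, exp q.2)

lemma continuous_escapeCoverMap : Continuous escapeCoverMap := by
  unfold escapeCoverMap
  fun_prop

lemma escapeCoverMap_mem {R : ℝ} {q : ℂ × ℂ} :
    escapeCoverMap q ∈ escapeRegion R ↔ q ∈ escapeCover R := by
  have h0 := Real.exp_pos q.2.re
  simp only [escapeCoverMap, escapeRegion, escapeCover, mem_ofPred_eq, norm_mul, norm_exp,
    mul_lt_iff_lt_one_left h0]
  exact and_comm

lemma convex_escapeCover (R : ℝ) : Convex ℝ (escapeCover R) := by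
  intro p hp q hq a b ha hb hab
  have h1 : Convex ℝ (Metric.ball (0 : ℂ) 1) := convex_ball 0 1
  refine ⟨?_, ?_⟩
  · have := h1 (mem_ball_zero_iff.2 hp.1) (mem_ball_zero_iff.2 hq.1) ha hb hab
    simpa using this
  · have h2 : OrdConnected {x : ℝ | R < Real.exp x} := by
      refine ordConnected_of_Ioo fun x hx y _ _ z hz => ?_
      exact lt_of_lt_of_le (show R < Real.exp x from hx) (Real.exp_le_exp.2 hz.1.le)
    have := h2.convex (𝕜 := ℝ) (show p.2.re ∈ _ from hp.2) (show q.2.re ∈ _ from hq.2) ha hb hab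
    simpa using this

namespace GenHenon

variable {H : GenHenon} {R : ℝ}

lemma mem_Uplus_iff (hR : 0 ≤ R) (hE : IsEscapeMap R H.m H.deg H.toFun) {z : ℂ × ℂ} :
    z ∈ H.Uplus ↔ ∃ n, H.toFun^[n] z ∈ escapeRegion R :=
  ⟨fun hz => hE.exists_iterate_mem hz, fun ⟨_, hn⟩ => hE.not_isBounded_of_iterate_mem hR H.hm hn⟩

lemma eventually_forall_iterate_mem (hE : IsEscapeMap R H.m H.deg H.toFun) {T : Type*}
    [TopologicalSpace T] [CompactSpace T] {f : T → ↥H.Uplus} (hf : Continuous f) :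
    ∀ᶠ n in atTop, ∀ t, H.toFun^[n] (f t) ∈ escapeRegion R := by
  obtain ⟨N, hN⟩ := isCompact_univ.elim_directed_cover
    (fun n => {t | H.toFun^[n] (f t) ∈ escapeRegion R})
    (fun n => (isOpen_escapeRegion R).preimage
      ((hE.continuous.iterate n).comp (continuous_subtype_val.comp hf)))
    (fun t _ => mem_iUnion.2 (hE.exists_iterate_mem (f t).2))
    (directed_of_isDirected_le fun i j hij t ht => hE.iterate_mem_of_le hij ht)
  filter_upwards [eventually_ge_atTop N] with n hn t
  exact hE.iterate_mem_of_le hn (hN (mem_univ t))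

/-- The loop `γ` has degree `q`: eventually the second coordinate of `Hⁿ ∘ γ` has winding number
`q dⁿ`. -/
def HasDegree {x : ↥H.Uplus} (γ : Path x x) (q : ℚ) : Prop :=
  ∀ᶠ n in atTop, HasLogIncrement (fun t => (H.toFun^[n] (γ t)).2)
    (q * (H.deg : ℂ) ^ n * (2 * Real.pi * Complex.I))

namespace HasDegree

variable {x : ↥H.Uplus}

lemma unique {γ : Path x x} {q q' : ℚ} (h : HasDegree γ q) (h' : HasDegree γ q') : q = q' := by
  obtain ⟨n, h1, h2⟩ := (h.and h').exists
  have h3 : (H.deg : ℂ) ≠ 0 := Nat.cast_ne_zero.2 H.deg_pos.ne'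
  have := mul_right_cancel₀ (pow_ne_zero n h3) (mul_right_cancel₀ two_pi_I_ne_zero (h1.unique h2))
  exact_mod_cast this

lemma of_single (hE : IsEscapeMap R H.m H.deg H.toFun) {γ : Path x x} {q : ℚ} {N : ℕ}
    (hV : ∀ t, H.toFun^[N] (γ t) ∈ escapeRegion R)
    (h : HasLogIncrement (fun t => (H.toFun^[N] (γ t)).2)
      (q * (H.deg : ℂ) ^ N * (2 * Real.pi * Complex.I))) : HasDegree γ q := by
  filter_upwards [eventually_ge_atTop N] with n hn
  induction n, hn using Nat.le_induction with
  | base => exact h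
  | succ n hn ih =>
    have h1 := hE.hasLogIncrement (fun t => H.toFun^[n] (γ t))
      ((hE.continuous.iterate n).comp (continuous_subtype_val.comp γ.continuous))
      (fun t => hE.iterate_mem_of_le hn (hV t)) (by simp only [γ.source, γ.target]) _ ih
    simp only [← Function.iterate_succ_apply' H.toFun] at h1
    convert h1 using 1
    ring

lemma exists_of_path (hE : IsEscapeMap R H.m H.deg H.toFun) (γ : Path x x) :
    ∃ q ∈ zdInv H.deg H.deg_pos, HasDegree γ q := by
  obtain ⟨N, hN⟩ := (eventually_forall_iterate_mem hE γ.continuous).exists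
  obtain ⟨c, hc⟩ := HasLogIncrement.of_continuous
    (f := fun t => (H.toFun^[N] (γ t)).2)
    (continuous_snd.comp ((hE.continuous.iterate N).comp
      (continuous_subtype_val.comp γ.continuous)))
    (fun t => norm_pos_iff.1 ((norm_nonneg _).trans_lt (hN t).2))
  obtain ⟨k, hk⟩ := exp_eq_one_iff.1 (hc.exp_eq_one (by simp only [γ.source, γ.target]))
  have h3 : (H.deg : ℂ) ≠ 0 := Nat.cast_ne_zero.2 H.deg_pos.ne'
  refine ⟨k / (H.deg : ℚ) ^ N, ⟨k, N, rfl⟩, of_single hE hN ?_⟩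
  push_cast
  rwa [div_mul_cancel₀ _ (pow_ne_zero N h3), ← hk]

lemma of_homotopic (hE : IsEscapeMap R H.m H.deg H.toFun) {γ δ : Path x x} {q : ℚ}
    (h : HasDegree γ q) (hγ : γ.Homotopic δ) : HasDegree δ q := by
  obtain ⟨F⟩ := hγ
  filter_upwards [eventually_forall_iterate_mem hE F.continuous, h] with n hn hq
  have := HasLogIncrement.of_homotopy (G := fun p => (H.toFun^[n] (F p)).2)
    (continuous_snd.comp ((hE.continuous.iterate n).comp
      (continuous_subtype_val.comp F.continuous)))
    (fun t => norm_pos_iff.1 ((norm_nonneg _).trans_lt (hn t).2))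
    (by simp) (by simp) (c := q * (H.deg : ℂ) ^ n * (2 * Real.pi * Complex.I)) (by simpa using hq)
  simpa using this

lemma trans {γ δ : Path x x} {q q' : ℚ} (h : HasDegree γ q) (h' : HasDegree δ q') :
    HasDegree (γ.trans δ) (q + q') := by
  filter_upwards [h, h'] with n h1 h2
  have := h1.path_trans (fun z : ↥H.Uplus => (H.toFun^[n] z).2) γ δ h2
  convert this using 1
  push_cast
  ring

lemma conj_map (hE : IsEscapeMap R H.m H.deg H.toFun) {γ : Path x x} {q : ℚ}
    (h : HasDegree γ q) (Hr : C(↥H.Uplus, ↥H.Uplus))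
    (hHr : ∀ u : ↥H.Uplus, (Hr u : ℂ × ℂ) = H.toFun ↑u) (σ : Path x (Hr x)) :
    HasDegree (σ.trans ((γ.map Hr.continuous).trans σ.symm)) (H.deg * q) := by
  filter_upwards [eventually_forall_iterate_mem hE σ.continuous,
    (tendsto_add_atTop_nat 1).eventually h] with n hn h1
  let g : ↥H.Uplus → ℂ := fun z => (H.toFun^[n] z).2
  obtain ⟨c, hc⟩ := HasLogIncrement.of_continuous (f := fun t => g (σ t))
    (continuous_snd.comp ((hE.continuous.iterate n).comp
      (continuous_subtype_val.comp σ.continuous)))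
    (fun t => norm_pos_iff.1 ((norm_nonneg _).trans_lt (hn t).2))
  have h2 : HasLogIncrement (fun t => g (γ.map Hr.continuous t))
      (q * (H.deg : ℂ) ^ (n + 1) * (2 * Real.pi * Complex.I)) := by
    simpa only [g, Path.map_coe, Function.comp_apply, hHr, ← Function.iterate_succ_apply]
      using h1
  have h3 := hc.path_trans g σ _ (h2.path_trans g _ _ (hc.path_symm g σ))
  convert h3 using 1
  push_cast
  ring

lemma homotopic_refl (hR : 0 ≤ R) (hE : IsEscapeMap R H.m H.deg H.toFun) {γ : Path x x}
    (h : HasDegree γ 0) : γ.Homotopic (Path.refl x) := by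
  obtain ⟨n, hn, w, hwc, hw, hw01⟩ :=
    ((eventually_forall_iterate_mem hE γ.continuous).and h).exists
  have hφ : Continuous fun t => H.toFun^[n] (γ t) :=
    (hE.continuous.iterate n).comp (continuous_subtype_val.comp γ.continuous)
  have hw' : w 0 = w 1 := by
    simp only [Rat.cast_zero, zero_mul] at hw01
    exact (sub_eq_zero.1 hw01).symm
  let l : unitInterval → ℂ × ℂ := fun t => ((H.toFun^[n] (γ t)).1 / exp (w t), w t)
  have hl : ∀ t, escapeCoverMap (l t) = H.toFun^[n] (γ t) := fun t => by
    ext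
    · exact div_mul_cancel₀ _ (exp_ne_zero _)
    · exact hw t
  have hlc : Continuous l :=
    (hφ.fst.div (by fun_prop) fun t => exp_ne_zero _).prodMk hwc
  have hlm : ∀ t, l t ∈ escapeCover R := fun t => by
    rw [← escapeCoverMap_mem, hl]
    exact hn t
  have hl01 : l 1 = l 0 := by simp [l, hw']
  have : ContractibleSpace ↥(escapeCover R) :=
    (convex_escapeCover R).contractibleSpace ⟨l 0, hlm 0⟩
  let L : Path (⟨l 0, hlm 0⟩ : ↥(escapeCover R)) ⟨l 0, hlm 0⟩ :=
    ⟨⟨fun t => ⟨l t, hlm t⟩, by fun_prop⟩, rfl, Subtype.ext hl01⟩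
  let Φ : C(↥(escapeCover R), ↥H.Uplus) :=
    ⟨fun q => ⟨H.invFun^[n] (escapeCoverMap q), (mem_Uplus_iff hR hE).2 ⟨n, by
      rw [H.toFun_invFun.iterate n]
      exact escapeCoverMap_mem.2 q.2⟩⟩,
      ((H.continuous_invFun.iterate n).comp
        (continuous_escapeCoverMap.comp continuous_subtype_val)).subtype_mk _⟩
  refine Path.homotopic_refl_of_factors Φ L γ fun t => Subtype.ext ?_
  change _ = H.invFun^[n] (escapeCoverMap (l t))
  rw [hl, H.invFun_toFun.iterate n]

lemma exists_path (hR : 0 ≤ R) (hE : IsEscapeMap R H.m H.deg H.toFun) (x : ↥H.Uplus) {q : ℚ}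
    (hq : q ∈ zdInv H.deg H.deg_pos) : ∃ γ : Path x x, HasDegree γ q := by
  obtain ⟨k, n, rfl⟩ := hq
  obtain ⟨i, hi⟩ := hE.exists_iterate_mem x.2
  obtain ⟨y, hy⟩ : ∃ y, H.toFun^[n + i] x = y := ⟨_, rfl⟩
  have hyV : y ∈ escapeRegion R := hy ▸ hE.iterate_mem_of_le (Nat.le_add_left i n) hi
  have hy0 : y.2 ≠ 0 := norm_pos_iff.1 ((norm_nonneg _).trans_lt hyV.2)
  have h3 : (H.deg : ℂ) ≠ 0 := Nat.cast_ne_zero.2 H.deg_pos.ne'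
  obtain ⟨c, hc⟩ : ∃ c : ℂ, c = (k * (H.deg : ℤ) ^ i : ℤ) * (2 * Real.pi * Complex.I) := ⟨_, rfl⟩
  have hc1 : exp c = 1 := exp_eq_one_iff.2 ⟨_, hc⟩
  have hcre : c.re = 0 := by simpa [norm_exp] using congrArg (‖·‖) hc1
  let l : unitInterval → ℂ × ℂ := fun t => (y.1 / y.2, Complex.log y.2 + ((t : ℝ) : ℂ) * c)
  have hlc : Continuous l := by fun_prop
  have hl0 : escapeCoverMap (l 0) = y := by
    ext <;> simp [escapeCoverMap, l, exp_log hy0, hy0]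
  have hl1 : escapeCoverMap (l 1) = y := by
    ext <;> simp [escapeCoverMap, l, exp_add, hc1, exp_log hy0, hy0]
  have hlm : ∀ t, escapeCoverMap (l t) ∈ escapeRegion R := fun t => by
    rw [← hl0, escapeCoverMap_mem] at hyV
    rw [escapeCoverMap_mem]
    simpa [escapeCover, l, hcre] using hyV
  have hx : H.invFun^[n + i] y = x := by rw [← hy, H.invFun_toFun.iterate]
  let γ : Path x x :=
    { toFun := fun t => ⟨H.invFun^[n + i] (escapeCoverMap (l t)),
        (mem_Uplus_iff hR hE).2 ⟨n + i, by
          rw [H.toFun_invFun.iterate]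
          exact hlm t⟩⟩
      continuous_toFun := ((H.continuous_invFun.iterate _).comp
        (continuous_escapeCoverMap.comp hlc)).subtype_mk _
      source' := Subtype.ext (by simp only [hl0, hx])
      target' := Subtype.ext (by simp only [hl1, hx]) }
  have hγ : ∀ t, H.toFun^[n + i] (γ t) = escapeCoverMap (l t) := fun t =>
    H.toFun_invFun.iterate _ _
  refine ⟨γ, of_single hE (N := n + i) (fun t => hγ t ▸ hlm t)
    ⟨fun t => (l t).2, by fun_prop, fun t => (congrArg Prod.snd (hγ t)).symm, ?_⟩⟩
  simp only [l, Icc.coe_one, Icc.coe_zero, hc]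
  push_cast
  rw [pow_add]
  field_simp
  ring

end HasDegree

end GenHenon

/-- **The fundamental group of the escaping set** (Theorem 2.1 (i)): `π₁(U⁺, x₀) ≅ ℤ[1/d]`,
and the isomorphism `α` can be chosen so that for any path `σ` from `x₀` to `H(x₀)` and any
loop `γ` at `x₀`, `α([σ · (H∘γ) · σ⁻¹]) = d · α([γ])`. -/
theorem fundamentalGroup_of_escaping_set (H : GenHenon) (hmonic : ∀ i, (H.p i).Monic) (x₀ : ↥H.Uplus) :
    ∃ α : FundamentalGroup ↥H.Uplus x₀ ≃* Multiplicative ↥(zdInv H.deg H.deg_pos),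
      ∀ (Hr : C(↥H.Uplus, ↥H.Uplus)),
        (∀ u : ↥H.Uplus, (Hr u : ℂ × ℂ) = H.toFun ↑u) →
        ∀ (σ : Path x₀ (Hr x₀)) (γ : Path x₀ x₀),
          Multiplicative.toAdd (α (fgFromPath ⟦(σ.trans ((γ.map Hr.continuous).trans σ.symm))⟧))
            = (H.deg : ℤ) • Multiplicative.toAdd (α (fgFromPath ⟦γ⟧)) := by
  obtain ⟨R, hR, hE⟩ := H.exists_isEscapeMap hmonic
  choose ν hν hdeg using GenHenon.HasDegree.exists_of_path hE (x := x₀)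
  have hν_eq : ∀ {γ : Path x₀ x₀} {q : ℚ}, GenHenon.HasDegree γ q → ν γ = q :=
    fun h => (hdeg _).unique h
  let a : FundamentalGroup ↥H.Uplus x₀ → Multiplicative ↥(zdInv H.deg H.deg_pos) :=
    Quotient.lift (fun γ => Multiplicative.ofAdd ⟨ν γ, hν γ⟩) fun γ δ h =>
      congrArg Multiplicative.ofAdd
        (Subtype.ext (hν_eq ((hdeg δ).of_homotopic hE (Path.Homotopic.symm h))))
  let A : FundamentalGroup ↥H.Uplus x₀ →* Multiplicative ↥(zdInv H.deg H.deg_pos) :=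
    MonoidHom.mk' a fun p q => by
      induction p using Quotient.inductionOn with | _ γ
      induction q using Quotient.inductionOn with | _ δ
      refine congrArg Multiplicative.ofAdd (Subtype.ext ?_)
      exact (hν_eq ((hdeg δ).trans (hdeg γ))).trans (add_comm _ _)
  have hinj : Function.Injective A := by
    refine (injective_iff_map_eq_one A).2 fun p hp => ?_
    induction p using Quotient.inductionOn with | _ γ
    have h0 : ν γ = 0 := congrArg Subtype.val (congrArg Multiplicative.toAdd hp)
    exact Quotient.sound ((h0 ▸ hdeg γ).homotopic_refl hR hE)
  have hsurj : Function.Surjective A := fun q => by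
    obtain ⟨γ, hγ⟩ := GenHenon.HasDegree.exists_path hR hE x₀ (Multiplicative.toAdd q).2
    exact ⟨fgFromPath ⟦γ⟧, congrArg Multiplicative.ofAdd (Subtype.ext (hν_eq hγ))⟩
  refine ⟨MulEquiv.ofBijective A ⟨hinj, hsurj⟩, fun Hr hHr σ γ => Subtype.ext ?_⟩
  change ν (σ.trans ((γ.map Hr.continuous).trans σ.symm)) = _
  rw [hν_eq ((hdeg γ).conj_map hE Hr hHr σ)]
  change _ =
    (((H.deg : ℤ) • (⟨ν γ, hν γ⟩ : ↥(zdInv H.deg H.deg_pos)) : ↥(zdInv H.deg H.deg_pos)) : ℚ)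
  simp
end
end
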